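/- Let λ, μ ∈ ℝ with μ > 0 and λ + μ > 0, set α := (λ+μ)/(λ+3μ), let ρ > 0 and let k ≥ 2 be an integer. Define the polynomial vector field g : ℝ² → ℝ² in polar coordinates by g(x) = ( r^k cos(kθ) − kα(r²−ρ²) r^{k−2} cos((k−2)θ), r^k sin(kθ) + kα(r²−ρ²) r^{k−2} sin((k−2)θ) ). Then μ Δg + (λ+μ)∇(∇·g) = 0 at every point of ℝ². -/

import Mathlib

open Real MeasureTheory

noncomputable section

/-- Partial derivative in the first coordinate direction. -/
def pdx (f : ℝ × ℝ → ℝ) (x : ℝ × ℝ) : ℝ := fderiv ℝ f x (1, 0)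

/-- Partial derivative in the second coordinate direction. -/
def pdy (f : ℝ × ℝ → ℝ) (x : ℝ × ℝ) : ℝ := fderiv ℝ f x (0, 1)

/-- Divergence of a planar vector field. -/
def div2 (u : ℝ × ℝ → ℝ × ℝ) (x : ℝ × ℝ) : ℝ :=
  pdx (fun y => (u y).1) x + pdy (fun y => (u y).2) x

/-- Componentwise Laplacian. -/
def lap2 (f : ℝ × ℝ → ℝ) (x : ℝ × ℝ) : ℝ :=
  pdx (fun y => pdx f y) x + pdy (fun y => pdy f y) x

/-- The Lamé operator  μ Δu + (λ+μ) ∇(∇·u). -/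
def lame2 (lam mu : ℝ) (u : ℝ × ℝ → ℝ × ℝ) (x : ℝ × ℝ) : ℝ × ℝ :=
  (mu * lap2 (fun y => (u y).1) x + (lam + mu) * pdx (fun y => div2 u y) x,
   mu * lap2 (fun y => (u y).2) x + (lam + mu) * pdy (fun y => div2 u y) x)

/-- Conormal derivative  λ(∇·u)ν + μ(∇u + (∇u)ᵀ)ν. -/
def trac (lam mu : ℝ) (u : ℝ × ℝ → ℝ × ℝ) (x ν : ℝ × ℝ) : ℝ × ℝ :=
  (lam * div2 u x * ν.1
      + mu * (2 * pdx (fun y => (u y).1) x * ν.1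
        + (pdy (fun y => (u y).1) x + pdx (fun y => (u y).2) x) * ν.2),
   lam * div2 u x * ν.2
      + mu * ((pdy (fun y => (u y).1) x + pdx (fun y => (u y).2) x) * ν.1
        + 2 * pdy (fun y => (u y).2) x * ν.2))

/-- Entries of the symmetric gradient ∇ˢu = (∇u + (∇u)ᵀ)/2. -/
def sg11 (u : ℝ × ℝ → ℝ × ℝ) (x : ℝ × ℝ) : ℝ := pdx (fun y => (u y).1) x

def sg12 (u : ℝ × ℝ → ℝ × ℝ) (x : ℝ × ℝ) : ℝ :=
  (pdy (fun y => (u y).1) x + pdx (fun y => (u y).2) x) / 2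

def sg22 (u : ℝ × ℝ → ℝ × ℝ) (x : ℝ × ℝ) : ℝ := pdy (fun y => (u y).2) x

/-- Frobenius inner product ∇ˢu : ∇ˢv of the symmetric gradients of two fields. -/
def sgFrob (u v : ℝ × ℝ → ℝ × ℝ) (x : ℝ × ℝ) : ℝ :=
  sg11 u x * sg11 v x + 2 * (sg12 u x * sg12 v x) + sg22 u x * sg22 v x

/-- Euclidean norm on ℝ². -/
def nr (x : ℝ × ℝ) : ℝ := Real.sqrt (x.1 ^ 2 + x.2 ^ 2)

/-- `f` is differentiable at `x` with partial derivatives `a` and `b`. -/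
def HasGrad (f : ℝ × ℝ → ℝ) (a b : ℝ) (x : ℝ × ℝ) : Prop :=
  HasFDerivAt f (a • ContinuousLinearMap.fst ℝ ℝ ℝ + b • ContinuousLinearMap.snd ℝ ℝ ℝ) x

namespace HasGrad

variable {f h : ℝ × ℝ → ℝ} {a b a' b' : ℝ} {x : ℝ × ℝ}

theorem pdx_eq (hf : HasGrad f a b x) : pdx f x = a := by
  simp [pdx, HasFDerivAt.fderiv hf]

theorem pdy_eq (hf : HasGrad f a b x) : pdy f x = b := by
  simp [pdy, HasFDerivAt.fderiv hf]

theorem add (hf : HasGrad f a b x) (hh : HasGrad h a' b' x) :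
    HasGrad (fun y => f y + h y) (a + a') (b + b') x := by
  refine (HasFDerivAt.add hf hh).congr_fderiv ?_
  ext <;> simp

theorem sub (hf : HasGrad f a b x) (hh : HasGrad h a' b' x) :
    HasGrad (fun y => f y - h y) (a - a') (b - b') x := by
  refine (HasFDerivAt.sub hf hh).congr_fderiv ?_
  ext <;> simp

theorem mul (hf : HasGrad f a b x) (hh : HasGrad h a' b' x) :
    HasGrad (fun y => f y * h y) (a * h x + f x * a') (b * h x + f x * b') x := by
  refine (HasFDerivAt.mul hf hh).congr_fderiv ?_
  ext <;> simp <;> ring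

theorem const_mul (c : ℝ) (hf : HasGrad f a b x) :
    HasGrad (fun y => c * f y) (c * a) (c * b) x := by
  refine (HasFDerivAt.const_mul hf c).congr_fderiv ?_
  ext <;> simp

theorem fst (x : ℝ × ℝ) : HasGrad (fun y => y.1) 1 0 x := by
  refine hasFDerivAt_fst.congr_fderiv ?_
  ext <;> simp

theorem snd (x : ℝ × ℝ) : HasGrad (fun y => y.2) 0 1 x := by
  refine hasFDerivAt_snd.congr_fderiv ?_
  ext <;> simp

end HasGrad

/-- The real part of `(x₁ + i x₂) ^ n`. -/
def rePow (n : ℕ) (x : ℝ × ℝ) : ℝ := (((⟨x.1, x.2⟩ : ℂ)) ^ n).re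

/-- The imaginary part of `(x₁ + i x₂) ^ n`. -/
def imPow (n : ℕ) (x : ℝ × ℝ) : ℝ := (((⟨x.1, x.2⟩ : ℂ)) ^ n).im

theorem rePow_succ (n : ℕ) (x : ℝ × ℝ) :
    rePow (n + 1) x = x.1 * rePow n x - x.2 * imPow n x := by
  simp only [rePow, imPow, pow_succ, Complex.mul_re]; ring

theorem imPow_succ (n : ℕ) (x : ℝ × ℝ) :
    imPow (n + 1) x = x.1 * imPow n x + x.2 * rePow n x := by
  simp only [rePow, imPow, pow_succ, Complex.mul_im]; ring

theorem hasGrad_rePow_imPow (n : ℕ) (x : ℝ × ℝ) :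
    HasGrad (rePow n) (n * rePow (n - 1) x) (-(n * imPow (n - 1) x)) x ∧
      HasGrad (imPow n) (n * imPow (n - 1) x) (n * rePow (n - 1) x) x := by
  induction n with
  | zero =>
    have hre : rePow 0 = fun _ => 1 := by ext; simp [rePow]
    have him : imPow 0 = fun _ => 0 := by ext; simp [imPow]
    constructor
    · simpa [HasGrad, hre] using hasFDerivAt_const (1 : ℝ) x
    · simpa [HasGrad, him] using hasFDerivAt_const (0 : ℝ) x
  | succ n ih =>
    obtain ⟨hre, him⟩ := ih
    have hr : (n : ℝ) * rePow n x
        = n * (x.1 * rePow (n - 1) x - x.2 * imPow (n - 1) x) := by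
      rcases n with _ | n
      · simp
      · simp [rePow_succ]
    have hi : (n : ℝ) * imPow n x
        = n * (x.1 * imPow (n - 1) x + x.2 * rePow (n - 1) x) := by
      rcases n with _ | n
      · simp
      · simp [imPow_succ]
    rw [funext (rePow_succ n), funext (imPow_succ n)]
    constructor
    · convert ((HasGrad.fst x).mul hre).sub ((HasGrad.snd x).mul him) using 1 <;>
        push_cast [Nat.add_sub_cancel] <;> linarith
    · convert ((HasGrad.fst x).mul him).add ((HasGrad.snd x).mul hre) using 1 <;>
        push_cast [Nat.add_sub_cancel] <;> linarith

theorem hasGrad_rePow (n : ℕ) (x : ℝ × ℝ) :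
    HasGrad (rePow n) (n * rePow (n - 1) x) (-(n * imPow (n - 1) x)) x :=
  (hasGrad_rePow_imPow n x).1

theorem hasGrad_imPow (n : ℕ) (x : ℝ × ℝ) :
    HasGrad (imPow n) (n * imPow (n - 1) x) (n * rePow (n - 1) x) x :=
  (hasGrad_rePow_imPow n x).2

theorem rePow_imPow_polar (n : ℕ) (r θ : ℝ) :
    rePow n (r * Real.cos θ, r * Real.sin θ) = r ^ n * Real.cos (n * θ) ∧
      imPow n (r * Real.cos θ, r * Real.sin θ) = r ^ n * Real.sin (n * θ) := by
  induction n with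
  | zero => simp [rePow, imPow]
  | succ n ih =>
    rw [rePow_succ, imPow_succ, ih.1, ih.2]
    push_cast
    rw [add_one_mul, Real.cos_add, Real.sin_add]
    constructor <;> ring

theorem rePow_polar (n : ℕ) (r θ : ℝ) :
    rePow n (r * Real.cos θ, r * Real.sin θ) = r ^ n * Real.cos (n * θ) :=
  (rePow_imPow_polar n r θ).1

theorem imPow_polar (n : ℕ) (r θ : ℝ) :
    imPow n (r * Real.cos θ, r * Real.sin θ) = r ^ n * Real.sin (n * θ) :=
  (rePow_imPow_polar n r θ).2

theorem exists_polar (x : ℝ × ℝ) :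
    ∃ r θ : ℝ, 0 ≤ r ∧ x = (r * Real.cos θ, r * Real.sin θ) := by
  refine ⟨‖(⟨x.1, x.2⟩ : ℂ)‖, Complex.arg ⟨x.1, x.2⟩, norm_nonneg _, ?_⟩
  rw [Complex.norm_mul_cos_arg, Complex.norm_mul_sin_arg]

/-- The field `z ^ (m + 2) - c z z̄ ^ (m + 1) + d z̄ ^ m`, where `z = x₁ + i x₂`. -/
def planarField (m : ℕ) (c d : ℝ) (x : ℝ × ℝ) : ℝ × ℝ :=
  (rePow (m + 2) x - c * (x.1 * rePow (m + 1) x + x.2 * imPow (m + 1) x) + d * rePow m x,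
    imPow (m + 2) x + c * (x.1 * imPow (m + 1) x - x.2 * rePow (m + 1) x) - d * imPow m x)

section planarField

variable (m : ℕ) (c d : ℝ) (x : ℝ × ℝ)

theorem hasGrad_planarField_fst :
    HasGrad (fun y => (planarField m c d y).1)
      ((m + 2) * rePow (m + 1) x
        - c * (rePow (m + 1) x + (m + 1) * (x.1 * rePow m x + x.2 * imPow m x))
        + d * (m * rePow (m - 1) x))
      (-((m + 2) * imPow (m + 1) x)
        - c * (imPow (m + 1) x + (m + 1) * (x.2 * rePow m x - x.1 * imPow m x))
        - d * (m * imPow (m - 1) x)) x := by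
  simp only [planarField]
  convert ((hasGrad_rePow (m + 2) x).sub ((((HasGrad.fst x).mul (hasGrad_rePow (m + 1) x)).add
    ((HasGrad.snd x).mul (hasGrad_imPow (m + 1) x))).const_mul c)).add
    ((hasGrad_rePow m x).const_mul d) using 1 <;>
  · simp only [Nat.add_sub_cancel, show m + 2 - 1 = m + 1 from rfl]
    push_cast
    ring

theorem hasGrad_planarField_snd :
    HasGrad (fun y => (planarField m c d y).2)
      ((m + 2) * imPow (m + 1) x
        + c * (imPow (m + 1) x + (m + 1) * (x.1 * imPow m x - x.2 * rePow m x))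
        - d * (m * imPow (m - 1) x))
      ((m + 2) * rePow (m + 1) x
        + c * (-rePow (m + 1) x + (m + 1) * (x.1 * rePow m x + x.2 * imPow m x))
        - d * (m * rePow (m - 1) x)) x := by
  simp only [planarField]
  convert ((hasGrad_imPow (m + 2) x).add ((((HasGrad.fst x).mul (hasGrad_imPow (m + 1) x)).sub
    ((HasGrad.snd x).mul (hasGrad_rePow (m + 1) x))).const_mul c)).sub
    ((hasGrad_imPow m x).const_mul d) using 1 <;>
  · simp only [Nat.add_sub_cancel, show m + 2 - 1 = m + 1 from rfl]
    push_cast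
    ring

theorem div2_planarField :
    div2 (planarField m c d) x = 2 * (m + 2 - c) * rePow (m + 1) x := by
  rw [div2, (hasGrad_planarField_fst m c d x).pdx_eq, (hasGrad_planarField_snd m c d x).pdy_eq]
  ring

theorem hasGrad_div2_planarField :
    HasGrad (fun y => div2 (planarField m c d) y)
      (2 * (m + 2 - c) * ((m + 1) * rePow m x)) (-(2 * (m + 2 - c) * ((m + 1) * imPow m x))) x := by
  simp only [div2_planarField]
  convert (hasGrad_rePow (m + 1) x).const_mul (2 * (m + 2 - c)) using 1 <;>
  · simp only [Nat.add_sub_cancel]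
    push_cast
    ring

theorem lap2_planarField_fst :
    lap2 (fun y => (planarField m c d y).1) x = -(4 * c * (m + 1) * rePow m x) := by
  have hx := ((((hasGrad_rePow (m + 1) x).const_mul (m + 2)).sub
    (((hasGrad_rePow (m + 1) x).add ((((HasGrad.fst x).mul (hasGrad_rePow m x)).add
      ((HasGrad.snd x).mul (hasGrad_imPow m x))).const_mul (m + 1))).const_mul c)).add
    (((hasGrad_rePow (m - 1) x).const_mul m).const_mul d)).pdx_eq
  have hy := (((((hasGrad_imPow (m + 1) x).const_mul (m + 2)).const_mul (-1)).sub
    (((hasGrad_imPow (m + 1) x).add ((((HasGrad.snd x).mul (hasGrad_rePow m x)).sub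
      ((HasGrad.fst x).mul (hasGrad_imPow m x))).const_mul (m + 1))).const_mul c)).sub
    (((hasGrad_imPow (m - 1) x).const_mul m).const_mul d)).pdy_eq
  simp only [neg_one_mul] at hy
  simp only [lap2, (hasGrad_planarField_fst m c d _).pdx_eq,
    (hasGrad_planarField_fst m c d _).pdy_eq]
  rw [hx, hy]
  simp only [Nat.add_sub_cancel]
  push_cast
  ring

theorem lap2_planarField_snd :
    lap2 (fun y => (planarField m c d y).2) x = 4 * c * (m + 1) * imPow m x := by
  have hx := ((((hasGrad_imPow (m + 1) x).const_mul (m + 2)).add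
    (((hasGrad_imPow (m + 1) x).add ((((HasGrad.fst x).mul (hasGrad_imPow m x)).sub
      ((HasGrad.snd x).mul (hasGrad_rePow m x))).const_mul (m + 1))).const_mul c)).sub
    (((hasGrad_imPow (m - 1) x).const_mul m).const_mul d)).pdx_eq
  have hy := ((((hasGrad_rePow (m + 1) x).const_mul (m + 2)).add
    ((((hasGrad_rePow (m + 1) x).const_mul (-1)).add ((((HasGrad.fst x).mul
      (hasGrad_rePow m x)).add
      ((HasGrad.snd x).mul (hasGrad_imPow m x))).const_mul (m + 1))).const_mul c)).sub
    (((hasGrad_rePow (m - 1) x).const_mul m).const_mul d)).pdy_eq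
  simp only [neg_one_mul] at hy
  simp only [lap2, (hasGrad_planarField_snd m c d _).pdx_eq,
    (hasGrad_planarField_snd m c d _).pdy_eq]
  rw [hx, hy]
  simp only [Nat.add_sub_cancel]
  push_cast
  ring

theorem lame2_planarField (lam mu : ℝ) :
    lame2 lam mu (planarField m c d) x =
      (2 * (m + 1) * ((lam + mu) * (m + 2) - (lam + 3 * mu) * c) * rePow m x,
        -(2 * (m + 1) * ((lam + mu) * (m + 2) - (lam + 3 * mu) * c) * imPow m x)) := by
  rw [lame2, lap2_planarField_fst, lap2_planarField_snd,
    (hasGrad_div2_planarField m c d x).pdx_eq, (hasGrad_div2_planarField m c d x).pdy_eq]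
  ext <;> ring

end planarField

/-- the polynomial field
g(x) = (r^k cos kθ − kα(r²−ρ²)r^{k−2} cos((k−2)θ), r^k sin kθ + kα(r²−ρ²)r^{k−2} sin((k−2)θ))
satisfies the Lamé equation μΔg + (λ+μ)∇(∇·g) = 0 at every point of ℝ². -/
theorem interior_plasmon_wave_satisfies_lame (lam mu : ℝ) (hmu : 0 < mu)
    (hlm : 0 < lam + mu) (α : ℝ) (hα : α = (lam + mu) / (lam + 3 * mu))
    (ρ : ℝ) (hρ : 0 < ρ) (k : ℕ) (hk : 2 ≤ k) (g : ℝ × ℝ → ℝ × ℝ)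
    (hg : ∀ r θ : ℝ, 0 ≤ r →
      g (r * Real.cos θ, r * Real.sin θ)
        = (r ^ k * Real.cos ((k : ℝ) * θ)
              - (k : ℝ) * α * (r ^ 2 - ρ ^ 2) * r ^ (k - 2) * Real.cos (((k : ℝ) - 2) * θ),
           r ^ k * Real.sin ((k : ℝ) * θ)
              + (k : ℝ) * α * (r ^ 2 - ρ ^ 2) * r ^ (k - 2) * Real.sin (((k : ℝ) - 2) * θ))) :
    ∀ x : ℝ × ℝ, lame2 lam mu g x = (0, 0) := by
  obtain ⟨m, rfl⟩ : ∃ m, k = m + 2 := ⟨k - 2, by omega⟩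
  have hg' : g = planarField m ((m + 2) * α) ((m + 2) * α * ρ ^ 2) := by
    funext x
    obtain ⟨r, θ, hr, rfl⟩ := exists_polar x
    have hm : ((m + 2 : ℕ) : ℝ) - 2 = m := by push_cast; ring
    have hre := rePow_succ m (r * Real.cos θ, r * Real.sin θ)
    have him := imPow_succ m (r * Real.cos θ, r * Real.sin θ)
    have hr2 : r ^ 2 = (r * Real.cos θ) ^ 2 + (r * Real.sin θ) ^ 2 := by
      linear_combination -r ^ 2 * Real.sin_sq_add_cos_sq θ
    rw [hg r θ hr, hm, Nat.add_sub_cancel, ← rePow_polar, ← imPow_polar,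
      mul_assoc _ (r ^ m), mul_assoc _ (r ^ m), ← rePow_polar, ← imPow_polar, hr2, planarField,
      hre, him]
    push_cast
    ext <;> dsimp only <;> ring
  intro x
  have hα' : α * (lam + 3 * mu) = lam + mu := (eq_div_iff (by linarith)).mp hα
  have hc : (lam + mu) * (m + 2) - (lam + 3 * mu) * ((m + 2) * α) = 0 := by
    linear_combination -(m + 2 : ℝ) * hα'
  rw [hg', lame2_planarField, hc]
  simp
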